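/- arXiv:math/0310052 — 2 statements merged into one kernel-verified Lean document; each statement's English description precedes it below -/
import Mathlib

section
/- Let I be a countable index set, let (z_i)_{i∈I} be points of ℝ² and (r_i)_{i∈I} positive reals, let N be a natural number, 0 < λ < 1 and 0 < δ < 1. Assume that every point of ℝ² belongs to at most N of the open balls B(z_i, (1+δ)r_i), and that for all i, j ∈ I, if B(z_i, (1+δ)r_i) ∩ B(z_j, (1+δ)r_j) ≠ ∅ then r_i ≥ λ·r_j. Let Ω := ⋃_{i∈I} B(z_i, r_i). Then there exists a family of functions φ_i : Ω → ℝ, each infinitely differentiable on Ω, such that: (i) 0 ≤ φ_i ≤ 1 for every i; (ii) φ_i vanishes on Ω \ B(z_i, (1+δ)r_i); (iii) ∑_{i∈I} φ_i(x) = 1 for every x ∈ Ω; and (iv) for every k ∈ ℕ there is a constant K_k, depending only on k, λ, δ and N, such that for every i ∈ I and every x ∈ Ω the k-th iterated derivative of φ_i at x has norm at most K_k · r_i^{−k}. -/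
open scoped ContDiff

section Quotient

open scoped Nat

lemma norm_iteratedFDerivWithin_inv_Ioi_le (n : ℕ) {x : ℝ} (hx : 1 ≤ x) :
    ‖iteratedFDerivWithin ℝ n (Inv.inv : ℝ → ℝ) (Set.Ioi 0) x‖ ≤ n ! := by
  have hx0 : 0 < x := by linarith
  rw [iteratedFDerivWithin_of_isOpen n isOpen_Ioi hx0, norm_iteratedFDeriv_eq_norm_iteratedDeriv,
    iteratedDeriv_eq_iterate, iter_deriv_inv]
  have hpow : x ^ (-1 - n : ℤ) ≤ 1 := zpow_le_one_of_nonpos₀ hx (by lia)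
  have hpow0 : 0 ≤ x ^ (-1 - n : ℤ) := by positivity
  rw [norm_mul, norm_mul, norm_pow, norm_neg, norm_one, one_pow, one_mul, Real.norm_natCast,
    Real.norm_of_nonneg hpow0]
  exact mul_le_of_le_one_right (by positivity) hpow

variable {E : Type*} [NormedAddCommGroup E] [NormedSpace ℝ E]

lemma norm_iteratedFDerivWithin_inv_le {U : Set E} (hU : IsOpen U) {T : E → ℝ}
    (hT : ContDiff ℝ ∞ T) (hT1 : ∀ y ∈ U, 1 ≤ T y) {x : E} (hx : x ∈ U) {A R : ℝ}
    (hA : 1 ≤ A) (hR : 0 < R) {n : ℕ} (hTb : ∀ m ≤ n, ‖iteratedFDeriv ℝ m T x‖ ≤ A * R ^ m) :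
    ‖iteratedFDerivWithin ℝ n (fun y => (T y)⁻¹) U x‖ ≤ n ! * n ! * (A * R) ^ n := by
  refine norm_iteratedFDerivWithin_comp_le (N := ∞) (g := Inv.inv) (t := Set.Ioi 0)
    (fun y hy => (contDiffAt_inv ℝ (ne_of_gt hy)).contDiffWithinAt) hT.contDiffOn
    (mod_cast le_top) isOpen_Ioi.uniqueDiffOn hU.uniqueDiffOn
    (fun y hy => zero_lt_one.trans_le (hT1 y hy)) hx (fun i hi => ?_) (fun i hi1 hi => ?_)
  · exact (norm_iteratedFDerivWithin_inv_Ioi_le i (hT1 x hx)).trans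
      (mod_cast Nat.factorial_le hi)
  · rw [iteratedFDerivWithin_of_isOpen i hU hx, mul_pow]
    refine (hTb i hi).trans ?_
    gcongr
    exact le_self_pow₀ hA (by lia)

lemma norm_iteratedFDerivWithin_div_le {U : Set E} (hU : IsOpen U) {f T : E → ℝ}
    (hf : ContDiff ℝ ∞ f) (hT : ContDiff ℝ ∞ T) (hT1 : ∀ y ∈ U, 1 ≤ T y) {x : E} (hx : x ∈ U)
    {A R : ℝ} (hA : 1 ≤ A) (hR : 0 < R) {k : ℕ}
    (hfb : ∀ m ≤ k, ‖iteratedFDeriv ℝ m f x‖ ≤ A * R ^ m)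
    (hTb : ∀ m ≤ k, ‖iteratedFDeriv ℝ m T x‖ ≤ A * R ^ m) :
    ‖iteratedFDerivWithin ℝ k (fun y => f y / T y) U x‖ ≤
      (∑ m ∈ Finset.range (k + 1),
        (k.choose m : ℝ) * A * ((k - m)! * (k - m)! * A ^ (k - m))) * R ^ k := by
  simp_rw [div_eq_mul_inv]
  refine (norm_iteratedFDerivWithin_mul_le (N := ∞) hf.contDiffOn
    (hT.contDiffOn.inv fun y hy => (zero_lt_one.trans_le (hT1 y hy)).ne') hU.uniqueDiffOn hx
    (mod_cast le_top)).trans ?_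
  rw [Finset.sum_mul]
  refine Finset.sum_le_sum fun m hm => ?_
  have hmk : m ≤ k := by simpa [Nat.lt_succ_iff] using hm
  have hinv := norm_iteratedFDerivWithin_inv_le hU hT hT1 hx hA hR (n := k - m)
    fun i hi => hTb i (by lia)
  rw [iteratedFDerivWithin_of_isOpen m hU hx]
  calc _ ≤ (k.choose m : ℝ) * (A * R ^ m) * ((k - m)! * (k - m)! * (A * R) ^ (k - m)) := by
        gcongr
        exacts [hfb m hmk, hinv]
    _ = _ := by
        rw [mul_pow, ← pow_mul_pow_sub R hmk]
        ring

lemma iteratedFDeriv_comp_smul_sub {f : E → ℝ} (hf : ContDiff ℝ ∞ f) (a : ℝ) (z x : E) (k : ℕ) :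
    iteratedFDeriv ℝ k (fun y => f (a • (y - z))) x =
      a ^ k • iteratedFDeriv ℝ k f (a • (x - z)) := by
  rw [iteratedFDeriv_comp_sub (f := fun y => f (a • y)),
    iteratedFDeriv_comp_const_smul a (hf.of_le (mod_cast le_top))]

end Quotient

lemma exists_nhds_forall_mem_ball_of_comparable {X I : Type*} [PseudoMetricSpace X] {lam δ : ℝ}
    (hlam : 0 < lam) (hδ : 0 < δ) {z : I → X} {r : I → ℝ} (hr : ∀ i, 0 < r i)
    (hcomp : ∀ i j, (Metric.ball (z i) ((1 + δ) * r i) ∩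
      Metric.ball (z j) ((1 + δ) * r j)).Nonempty → lam * r j ≤ r i)
    {x : X} (hx : x ∈ ⋃ i, Metric.ball (z i) (r i)) :
    ∃ U : Set X, IsOpen U ∧ x ∈ U ∧ U ⊆ ⋃ i, Metric.ball (z i) (r i) ∧
      ∀ y ∈ U, ∀ j, dist y (z j) < (1 + δ / 2) * r j → x ∈ Metric.ball (z j) ((1 + δ) * r j) := by
  obtain ⟨i, hi⟩ := Set.mem_iUnion.1 hx
  have hri := hr i
  refine ⟨Metric.ball x (lam * δ / 2 * r i) ∩ Metric.ball (z i) (r i),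
    Metric.isOpen_ball.inter Metric.isOpen_ball, ⟨Metric.mem_ball_self (by positivity), hi⟩,
    Set.inter_subset_right.trans (Set.subset_iUnion (fun i => Metric.ball (z i) (r i)) i), ?_⟩
  rintro y ⟨hyx, hyi⟩ j hyj
  rw [Metric.mem_ball] at hyx hyi ⊢
  have hrj := hr j
  have hji : lam * r i ≤ r j :=
    hcomp j i ⟨y, Metric.mem_ball.2 (by nlinarith), Metric.mem_ball.2 (by nlinarith)⟩
  have := dist_triangle_left x (z j) y
  nlinarith

lemma exists_smooth_cutoff_with_bounds (E : Type*) [NormedAddCommGroup E] [InnerProductSpace ℝ E]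
    [FiniteDimensional ℝ E] {ρ : ℝ} (hρ : 1 < ρ) :
    ∃ (ψ : E → ℝ) (C : ℕ → ℝ), ContDiff ℝ ∞ ψ ∧ (∀ x, 0 ≤ ψ x) ∧ (∀ x, ‖x‖ ≤ 1 → ψ x = 1) ∧
      (∀ x, ρ ≤ ‖x‖ → ψ x = 0) ∧ ∀ k x, ‖iteratedFDeriv ℝ k ψ x‖ ≤ C k := by
  let ψ : ContDiffBump (0 : E) := ⟨1, ρ, zero_lt_one, hρ⟩
  have hψ : ContDiff ℝ ∞ ψ := ψ.contDiff
  choose C hC using fun k : ℕ =>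
    (hψ.continuous_iteratedFDeriv (m := k) (mod_cast le_top)).bounded_above_of_compact_support
      (ψ.hasCompactSupport.iteratedFDeriv k)
  exact ⟨ψ, C, hψ, ψ.nonneg', fun x hx => ψ.one_of_mem_closedBall (by simpa [ψ] using hx),
    fun x hx => ψ.zero_of_le_dist (by simpa [ψ] using hx), hC⟩

/-- Smooth partition of unity adapted to a Whitney–Besicovitch covering of the plane:
given a countable family of balls `B(z_i, r_i)` whose `(1+δ)`-enlargements have
multiplicity at most `N` and comparable radii on intersection, there are smooth
functions `φ_i` on `Ω = ⋃ B(z_i, r_i)`, with `0 ≤ φ_i ≤ 1`, `φ_i = 0` outside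
`B(z_i, (1+δ) r_i)`, `∑ φ_i = 1` on `Ω`, and with `k`-th derivatives bounded by
`K k * r_i ^ (-k)` where `K` depends only on `k`, `lam`, `δ` and `N`. -/
theorem whitney_besicovitch_partition_of_unity
    (lam δ : ℝ) (hlam0 : 0 < lam) (hlam1 : lam < 1) (hδ0 : 0 < δ) (hδ1 : δ < 1) (N : ℕ) :
    ∃ K : ℕ → ℝ, ∀ (I : Type) (_ : Countable I)
      (z : I → EuclideanSpace ℝ (Fin 2)) (r : I → ℝ),
      (∀ i, 0 < r i) →
      (∀ x : EuclideanSpace ℝ (Fin 2),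
        {i : I | x ∈ Metric.ball (z i) ((1 + δ) * r i)}.encard ≤ (N : ℕ∞)) →
      (∀ i j : I, (Metric.ball (z i) ((1 + δ) * r i) ∩
          Metric.ball (z j) ((1 + δ) * r j)).Nonempty → lam * r j ≤ r i) →
      ∃ φ : I → EuclideanSpace ℝ (Fin 2) → ℝ,
        (∀ i, ContDiffOn ℝ (⊤ : ℕ∞) (φ i) (⋃ i', Metric.ball (z i') (r i'))) ∧
        (∀ i, ∀ x ∈ (⋃ i', Metric.ball (z i') (r i')), 0 ≤ φ i x ∧ φ i x ≤ 1) ∧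
        (∀ i, ∀ x ∈ (⋃ i', Metric.ball (z i') (r i')) \
            Metric.ball (z i) ((1 + δ) * r i), φ i x = 0) ∧
        (∀ x ∈ (⋃ i', Metric.ball (z i') (r i')), ∑' i, φ i x = 1) ∧
        (∀ k : ℕ, ∀ i, ∀ x ∈ (⋃ i', Metric.ball (z i') (r i')),
          ‖iteratedFDerivWithin ℝ k (φ i) (⋃ i', Metric.ball (z i') (r i')) x‖
            ≤ K k * (r i) ^ (-(k : ℤ))) := by
  obtain ⟨ψ, C, hψ, hψ0, hψ1, hψout, hC⟩ :=
    exists_smooth_cutoff_with_bounds (EuclideanSpace ℝ (Fin 2)) (ρ := 1 + δ / 2) (by linarith)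
  have hC0 : ∀ k, 0 ≤ C k := fun k => (norm_nonneg _).trans (hC k 0)
  let A : ℕ → ℝ := fun k => 1 + ∑ m ∈ Finset.range (k + 1), (N + 1) * (C m * lam⁻¹ ^ m)
  have hA1 : ∀ k, 1 ≤ A k := fun k => le_add_of_nonneg_right <|
    Finset.sum_nonneg fun m _ => by have := hC0 m; positivity
  have hA : ∀ k, ∀ m ≤ k, (N + 1) * (C m * lam⁻¹ ^ m) ≤ A k := fun k m hm =>
    (Finset.single_le_sum (f := fun m => (N + 1) * (C m * lam⁻¹ ^ m))
      (fun m _ => by have := hC0 m; positivity)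
      (Finset.mem_range.2 (Nat.lt_succ_of_le hm))).trans (le_add_of_nonneg_left zero_le_one)
  refine ⟨fun k => ∑ m ∈ Finset.range (k + 1),
    (k.choose m : ℝ) * A k * ((k - m).factorial * (k - m).factorial * A k ^ (k - m)), ?_⟩
  intro I _ z r hr hmult hcomp
  set Ω := ⋃ i, Metric.ball (z i) (r i)
  have hΩo : IsOpen Ω := isOpen_iUnion fun _ => Metric.isOpen_ball
  let χ : I → EuclideanSpace ℝ (Fin 2) → ℝ := fun i x => ψ ((r i)⁻¹ • (x - z i))
  have hχ : ∀ i, ContDiff ℝ ∞ (χ i) := fun i => by fun_prop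
  have hχ0 : ∀ i x, 0 ≤ χ i x := fun i x => hψ0 _
  have hnorm : ∀ i x, ‖(r i)⁻¹ • (x - z i)‖ = dist x (z i) / r i := fun i x => by
    rw [norm_smul, norm_inv, Real.norm_of_nonneg (hr i).le, dist_eq_norm, inv_mul_eq_div]
  have hχ1 : ∀ i, ∀ x ∈ Metric.ball (z i) (r i), χ i x = 1 := fun i x hx =>
    hψ1 _ (by rw [hnorm, div_le_one (hr i)]; exact (Metric.mem_ball.1 hx).le)
  have hχout : ∀ i x, (1 + δ / 2) * r i ≤ dist x (z i) → χ i x = 0 := fun i x hx =>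
    hψout _ (by rw [hnorm, le_div_iff₀ (hr i)]; exact hx)
  have hχC : ∀ k i x, ‖iteratedFDeriv ℝ k (χ i) x‖ ≤ C k * (r i)⁻¹ ^ k := fun k i x => by
    have := hr i
    rw [iteratedFDeriv_comp_smul_sub hψ, norm_smul, Real.norm_of_nonneg (by positivity), mul_comm]
    gcongr
    exact hC k _
  have hfin : ∀ x, {i | x ∈ Metric.ball (z i) ((1 + δ) * r i)}.Finite := fun x =>
    Set.finite_of_encard_le_coe (hmult x)
  let F : EuclideanSpace ℝ (Fin 2) → Finset I := fun x => (hfin x).toFinset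
  have hF : ∀ x i, i ∈ F x ↔ x ∈ Metric.ball (z i) ((1 + δ) * r i) := fun x i => by simp [F]
  have hFcard : ∀ x, (F x).card ≤ N := fun x => by
    have := hmult x
    rw [(hfin x).encard_eq_coe_toFinset_card] at this
    exact_mod_cast this
  have hχF : ∀ x, ∀ i ∉ F x, χ i x = 0 := fun x i hi => hχout i x <| by
    rw [hF, Metric.mem_ball, not_lt] at hi
    nlinarith [hr i]
  have hsummable : ∀ x, Summable fun i => χ i x := fun x =>
    summable_of_ne_finset_zero (s := F x) (hχF x)
  let S : EuclideanSpace ℝ (Fin 2) → ℝ := fun x => ∑' i, χ i x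
  have hχS : ∀ i x, χ i x ≤ S x := fun i x => (hsummable x).le_tsum i fun j _ => hχ0 j x
  have hS1 : ∀ x ∈ Ω, 1 ≤ S x := fun x hx => by
    obtain ⟨i, hi⟩ := Set.mem_iUnion.1 hx
    exact (hχ1 i x hi).ge.trans (hχS i x)
  have hloc : ∀ x ∈ Ω, ∃ U, IsOpen U ∧ x ∈ U ∧ U ⊆ Ω ∧ (∀ y ∈ U, ∀ j ∉ F x, χ j y = 0) ∧
      ∀ y ∈ U, S y = ∑ j ∈ F x, χ j y := fun x hx => by
    obtain ⟨U, hU, hxU, hUΩ, h⟩ :=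
      exists_nhds_forall_mem_ball_of_comparable hlam0 hδ0 hr hcomp hx
    have hout : ∀ y ∈ U, ∀ j ∉ F x, χ j y = 0 := fun y hy j hj => hχout j y <|
      not_lt.1 fun hlt => hj ((hF x j).2 (h y hy j hlt))
    exact ⟨U, hU, hxU, hUΩ, hout, fun y hy => tsum_eq_sum (hout y hy)⟩
  refine ⟨fun i x => χ i x / S x, fun i x hx => ?_, fun i x hx => ⟨?_, ?_⟩, fun i x hx => ?_,
    fun x hx => ?_, fun k i x hx => ?_⟩
  · obtain ⟨U, hU, hxU, -, -, hS⟩ := hloc x hx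
    have hSx : ContDiffAt ℝ ∞ S x :=
      (ContDiff.sum (s := F x) fun j _ => hχ j).contDiffAt.congr_of_eventuallyEq
        (Filter.eventually_of_mem (hU.mem_nhds hxU) hS)
    exact ((hχ i).contDiffAt.div hSx (zero_lt_one.trans_le (hS1 x hx)).ne').contDiffWithinAt
  · exact div_nonneg (hχ0 i x) (zero_le_one.trans (hS1 x hx))
  · exact div_le_one_of_le₀ (hχS i x) (zero_le_one.trans (hS1 x hx))
  · simp [hχF x i fun h => hx.2 ((hF x i).1 h)]
  · rw [tsum_div_const]
    exact div_self (zero_lt_one.trans_le (hS1 x hx)).ne'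
  · obtain ⟨U, hU, hxU, hUΩ, hout, hS⟩ := hloc x hx
    have hri := hr i
    rw [iteratedFDerivWithin_of_isOpen k hΩo hx, ← iteratedFDerivWithin_of_isOpen k hU hxU,
      zpow_neg, zpow_natCast, ← inv_pow]
    by_cases hi : i ∈ F x
    · have heq : Set.EqOn (fun y => χ i y / S y) (fun y => χ i y / ∑ j ∈ F x, χ j y) U :=
        fun y hy => by simp only [hS y hy]
      rw [iteratedFDerivWithin_congr heq hxU]
      refine norm_iteratedFDerivWithin_div_le hU (hχ i) (ContDiff.sum fun j _ => hχ j)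
        (fun y hy => (hS1 y (hUΩ hy)).trans_eq (hS y hy)) hxU (hA1 k) (inv_pos.2 hri)
        (fun m hm => ?_) (fun m hm => ?_)
      · refine (hχC m i x).trans ?_
        gcongr
        refine le_trans ?_ (hA k m hm)
        have h1 : 1 ≤ lam⁻¹ ^ m := one_le_pow₀ ((one_le_inv₀ hlam0).2 hlam1.le)
        have h2 : C m ≤ C m * lam⁻¹ ^ m := le_mul_of_one_le_right (hC0 m) h1
        exact h2.trans (le_mul_of_one_le_left ((hC0 m).trans h2) (by simp))
      · rw [iteratedFDeriv_fun_sum_apply fun j _ => (hχ j).contDiffAt.of_le (mod_cast le_top)]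
        have hterm : ∀ j ∈ F x,
            ‖iteratedFDeriv ℝ m (χ j) x‖ ≤ C m * (lam⁻¹ * (r i)⁻¹) ^ m := fun j hj => by
          refine (hχC m j x).trans ?_
          have hrj := hr j
          have := hC0 m
          have hji : lam * r i ≤ r j := hcomp j i ⟨x, (hF x j).1 hj, (hF x i).1 hi⟩
          rw [← mul_inv]
          gcongr
        calc _ ≤ (F x).card • (C m * (lam⁻¹ * (r i)⁻¹) ^ m) :=
              norm_sum_le_of_le _ hterm |>.trans_eq (by simp)
          _ ≤ (N + 1) * (C m * (lam⁻¹ * (r i)⁻¹) ^ m) := by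
              have := hC0 m
              have hcard : ((F x).card : ℝ) ≤ N := mod_cast hFcard x
              rw [nsmul_eq_mul]
              gcongr
              linarith
          _ = (N + 1) * (C m * lam⁻¹ ^ m) * (r i)⁻¹ ^ m := by rw [mul_pow]; ring
          _ ≤ A k * (r i)⁻¹ ^ m := by gcongr; exact hA k m hm
    · have heq : Set.EqOn (fun y => χ i y / S y) (fun _ => (0 : ℝ)) U :=
        fun y hy => by simp [hout y hy i hi]
      have hAk := zero_le_one.trans (hA1 k)
      rw [iteratedFDerivWithin_congr heq hxU, iteratedFDerivWithin_fun_zero]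
      simp only [Pi.zero_apply, norm_zero]
      positivity
end

section
/- Let m ∈ ℝ and let u be a real-valued function on ℝ² which is continuous on (closed unit ball) \ {0}, twice continuously differentiable and harmonic (Δu = 0) on (open unit ball) \ {0}, and has finite Dirichlet energy: ∫_{B₁ \ {0}} ‖∇u‖² < ∞. If u(x) ≤ m for every x with ‖x‖ = 1, then u(x) ≤ m for every x in the closed unit ball with x ≠ 0. -/
open Metric MeasureTheory

open Set Filter Topology Complex InnerProductSpace
open scoped ENNReal

/-- **Maximum principle** for harmonic functions on a disk. -/
theorem InnerProductSpace.HarmonicContOnCl.le_of_forall_mem_sphere_le {f : ℂ → ℝ} {c : ℂ}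
    {R m : ℝ} (hR : 0 < R) (hf : HarmonicContOnCl f (ball c R))
    (hm : ∀ z ∈ sphere c R, f z ≤ m) {z : ℂ} (hz : z ∈ closedBall c R) : f z ≤ m := by
  have hcont : ContinuousOn f (closedBall c R) := hf.continuousOn_ball
  obtain ⟨p, hp, hpmax⟩ := (isCompact_closedBall c R).exists_isMaxOn ⟨z, hz⟩ hcont
  refine (hpmax hz).trans ?_
  by_cases hps : p ∈ sphere c R
  · exact hm p hps
  have hpb : p ∈ ball c R := lt_of_le_of_ne hp hps
  obtain ⟨F, hF, hFf⟩ := hf.harmonicOnNhd.exists_analyticOnNhd_ball_re_eq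
  have hnorm : ∀ w ∈ ball c R, ‖Complex.exp (F w)‖ = Real.exp (f w) := fun w hw ↦ by
    rw [Complex.norm_exp]
    exact congrArg Real.exp (hFf hw)
  have hconst := Complex.norm_eqOn_of_isPreconnected_of_isMaxOn (f := fun w ↦ Complex.exp (F w))
    (convex_ball c R).isPreconnected isOpen_ball hF.differentiableOn.cexp hpb (fun w hw ↦ by
      simpa [hnorm w hw, hnorm p hpb] using! hpmax (ball_subset_closedBall hw))
  have hfp : EqOn f (fun _ ↦ f p) (ball c R) := fun w hw ↦ by
    have := hconst hw
    simpa [hnorm w hw, hnorm p hpb] using this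
  have hfp' : EqOn f (fun _ ↦ f p) (closedBall c R) :=
    hfp.of_subset_closure hcont continuousOn_const ball_subset_closedBall
      (closure_ball c hR.ne').ge
  have hq : c + R ∈ sphere c R := by simp [hR.le]
  exact (hfp' (sphere_subset_closedBall hq)).ge.trans (hm _ hq)

/-- The Laplacian commutes with right composition by linear isometric equivalences. -/
theorem LinearIsometryEquiv.laplacian_comp_right {E E' F : Type*}
    [NormedAddCommGroup E] [InnerProductSpace ℝ E] [FiniteDimensional ℝ E]
    [NormedAddCommGroup E'] [InnerProductSpace ℝ E'] [FiniteDimensional ℝ E']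
    [NormedAddCommGroup F] [NormedSpace ℝ F] (e : E ≃ₗᵢ[ℝ] E') (f : E' → F) (x : E) :
    Laplacian.laplacian (f ∘ e) x = Laplacian.laplacian f (e x) := by
  rw [laplacian_eq_iteratedFDeriv_stdOrthonormalBasis,
    laplacian_eq_iteratedFDeriv_orthonormalBasis f ((stdOrthonormalBasis ℝ E).map e)]
  refine Finset.sum_congr rfl fun i _ ↦ ?_
  have h := e.toContinuousLinearEquiv.iteratedFDerivWithin_comp_right f uniqueDiffOn_univ
    (mem_univ (e x)) 2
  simp only [preimage_univ, iteratedFDerivWithin_univ] at h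
  refine (congrArg (· ![stdOrthonormalBasis ℝ E i, stdOrthonormalBasis ℝ E i]) h).trans ?_
  rw [ContinuousMultilinearMap.compContinuousLinearMap_apply]
  refine congrArg (iteratedFDeriv ℝ 2 f (e x)) (funext fun j ↦ ?_)
  fin_cases j <;> simp

/-- The punctured disk is connected. -/
theorem Complex.isPreconnected_ball_sdiff_singleton (R : ℝ) :
    IsPreconnected (ball (0 : ℂ) R \ {0}) := by
  rcases le_or_gt R 0 with hR | hR
  · simpa [ball_eq_empty.2 hR] using isPreconnected_empty
  have hR' : (R : ℂ) ≠ 0 := mod_cast hR.ne'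
  have h : ball (0 : ℂ) R \ {0} = (fun z ↦ R * Complex.exp z) '' {z : ℂ | z.re < 0} := by
    ext z
    simp only [Set.mem_sdiff, mem_ball_zero_iff, mem_singleton_iff, mem_image, Set.mem_ofPred_eq]
    constructor
    · rintro ⟨hz, hz0⟩
      refine ⟨Complex.log (z / R), ?_, ?_⟩
      · rw [Complex.log_re, norm_div, Complex.norm_real, Real.norm_of_nonneg hR.le]
        exact Real.log_neg (by positivity) ((div_lt_one hR).2 hz)
      · rw [Complex.exp_log (div_ne_zero hz0 hR'), mul_div_cancel₀ _ hR']
    · rintro ⟨w, hw, rfl⟩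
      refine ⟨?_, mul_ne_zero hR' (Complex.exp_ne_zero w)⟩
      rw [norm_mul, Complex.norm_real, Real.norm_of_nonneg hR.le, Complex.norm_exp]
      exact mul_lt_of_lt_one_right hR (by simpa using hw)
  rw [h]
  exact (convex_halfSpace_re_lt 0).isPreconnected.image _ (by fun_prop)

/-- Sub-mean value property of the norm of a holomorphic function over a disk. -/
theorem DifferentiableOn.mul_enorm_le_lintegral_ball {g : ℂ → ℂ} {c : ℂ} {R : ℝ}
    (hR : 0 ≤ R) (hg : DifferentiableOn ℂ g (ball c R)) :
    ENNReal.ofReal (Real.pi * R ^ 2) * ‖g c‖ₑ ≤ ∫⁻ z in ball c R, ‖g z‖ₑ := by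
  classical
  have hcircle : ∀ r ∈ Ioo 0 R, ENNReal.ofReal (2 * Real.pi) * ‖g c‖ₑ ≤
      ∫⁻ θ in Ioo (-Real.pi) Real.pi, ‖g (circleMap c r θ)‖ₑ := by
    intro r hr
    have hav : Real.circleAverage g c r = g c := by
      apply DiffContOnCl.circleAverage
      rw [abs_of_pos hr.1]
      exact (hg.mono (closedBall_subset_ball hr.2)).diffContOnCl_ball le_rfl
    have hper : Function.Periodic (fun θ ↦ g (circleMap c r θ)) (2 * Real.pi) :=
      fun θ ↦ by simp only [periodic_circleMap c r θ]
    have hint : ∫ θ in Ioo (-Real.pi) Real.pi, g (circleMap c r θ) = (2 * Real.pi) • g c := by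
      rw [← hav, Real.circleAverage_def, smul_inv_smul₀ (by positivity),
        ← integral_Ioc_eq_integral_Ioo,
        ← intervalIntegral.integral_of_le (by linarith [Real.pi_pos])]
      convert hper.intervalIntegral_add_eq (-Real.pi) 0 using 2 <;> ring
    calc ENNReal.ofReal (2 * Real.pi) * ‖g c‖ₑ = ‖(2 * Real.pi) • g c‖ₑ := by
          rw [enorm_smul, Real.enorm_of_nonneg (by positivity)]
      _ ≤ _ := hint ▸ enorm_integral_le_lintegral_enorm _
  set h : ℂ → ℝ≥0∞ := (ball c R).indicator (fun z ↦ ‖g z‖ₑ) with hh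
  have hmeas : Measurable h := by
    refine ContinuousOn.measurable_piecewise (g := fun _ ↦ 0) ?_ continuousOn_const
      measurableSet_ball
    exact continuous_enorm.comp_continuousOn hg.continuousOn
  have hpolar : ∫⁻ z in ball c R, ‖g z‖ₑ =
      ∫⁻ r in Ioi (0 : ℝ), ∫⁻ θ in Ioo (-Real.pi) Real.pi,
        ENNReal.ofReal r * h (circleMap c r θ) := by
    rw [← lintegral_indicator measurableSet_ball, ← lintegral_add_left_eq_self _ c,
      ← Complex.lintegral_comp_polarCoord_symm, polarCoord_target, Measure.volume_eq_prod,
      setLIntegral_prod]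
    · simp [circleMap, Complex.exp_mul_I, hh]
    · refine Measurable.aemeasurable ?_
      have : Measurable fun p : ℝ × ℝ ↦ c + Complex.polarCoord.symm p := by
        simp only [Complex.polarCoord_symm_apply]
        fun_prop
      exact measurable_fst.ennreal_ofReal.mul (hmeas.comp this)
  rw [hpolar]
  calc ENNReal.ofReal (Real.pi * R ^ 2) * ‖g c‖ₑ
      = ∫⁻ r in Ioo 0 R, ENNReal.ofReal r * (ENNReal.ofReal (2 * Real.pi) * ‖g c‖ₑ) := by
        rw [lintegral_mul_const _ (by fun_prop), ← mul_assoc,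
          ← ofReal_integral_eq_lintegral_ofReal, ← integral_Ioc_eq_integral_Ioo,
          ← intervalIntegral.integral_of_le hR, integral_id, ← ENNReal.ofReal_mul' (by positivity)]
        · ring_nf
        · exact (continuous_id.integrableOn_Icc (a := 0) (b := R)).mono_set Ioo_subset_Icc_self
        · filter_upwards [self_mem_ae_restrict measurableSet_Ioo] with r hr using hr.1.le
    _ ≤ ∫⁻ r in Ioo 0 R, ∫⁻ θ in Ioo (-Real.pi) Real.pi,
        ENNReal.ofReal r * h (circleMap c r θ) := by
        refine setLIntegral_mono' measurableSet_Ioo fun r hr ↦ ?_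
        rw [lintegral_const_mul _ (by fun_prop)]
        gcongr
        refine (hcircle r hr).trans_eq (lintegral_congr fun θ ↦ ?_)
        rw [hh, indicator_of_mem]
        simp [circleMap, abs_of_pos hr.1, hr.2]
    _ ≤ _ := lintegral_mono_set Ioo_subset_Ioi_self

/-- An isolated singularity of a square-integrable holomorphic function is removable. -/
theorem exists_differentiableOn_ball_eqOn_of_lintegral_sq_ne_top {f : ℂ → ℂ} {R : ℝ} (hR : 0 < R)
    (hf : DifferentiableOn ℂ f (ball 0 R \ {0}))
    (hfin : ∫⁻ z in ball 0 R \ {0}, ‖f z‖ₑ ^ 2 ≠ ∞) :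
    ∃ F : ℂ → ℂ, DifferentiableOn ℂ F (ball 0 R) ∧ EqOn F f (ball 0 R \ {0}) := by
  have hsub : ∀ᶠ z : ℂ in 𝓝[≠] 0, ball z ‖z‖ ⊆ ball 0 R \ {0} := by
    filter_upwards [nhdsWithin_le_nhds (ball_mem_nhds (0 : ℂ) (half_pos hR))] with z hz
    intro w hw
    simp only [mem_ball_iff_norm, sub_zero, Set.mem_sdiff, mem_singleton_iff] at hz hw ⊢
    constructor
    · linarith [norm_le_norm_add_norm_sub z w, norm_sub_rev w z]
    · rintro rfl
      simp at hw
  have hvol : Tendsto (fun z : ℂ ↦ volume (ball z ‖z‖)) (𝓝[≠] 0) (𝓝 0) := by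
    simp only [Complex.volume_ball]
    have : Continuous fun z : ℂ ↦ ENNReal.ofReal ‖z‖ ^ 2 * (NNReal.pi : ℝ≥0∞) :=
      (ENNReal.continuous_mul_const ENNReal.coe_ne_top).comp
        ((ENNReal.continuous_pow 2).comp (ENNReal.continuous_ofReal.comp continuous_norm))
    exact (this.tendsto' 0 0 (by simp)).mono_left nhdsWithin_le_nhds
  have hlim : Tendsto (fun z : ℂ ↦ ∫⁻ w in ball z ‖z‖, ‖f w‖ₑ ^ 2) (𝓝[≠] 0) (𝓝 0) := by
    have := tendsto_setLIntegral_zero hfin (l := 𝓝[≠] 0) (s := fun z : ℂ ↦ ball z ‖z‖)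
      (tendsto_of_tendsto_of_tendsto_of_le_of_le tendsto_const_nhds hvol (fun _ ↦ zero_le)
        (fun z ↦ Measure.restrict_apply_le _ _))
    refine this.congr' ?_
    filter_upwards [hsub] with z hz
    rw [Measure.restrict_restrict_of_subset hz]
  have hsq : Tendsto (fun z : ℂ ↦ ‖(z * f z) ^ 2‖ₑ) (𝓝[≠] 0) (𝓝 0) := by
    refine tendsto_of_tendsto_of_tendsto_of_le_of_le' tendsto_const_nhds hlim
      (Eventually.of_forall fun _ ↦ zero_le) ?_
    filter_upwards [hsub] with z hz
    have := DifferentiableOn.mul_enorm_le_lintegral_ball (norm_nonneg z) ((hf.mono hz).pow 2)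
    simp only [enorm_pow, Pi.pow_apply] at this
    refine le_trans ?_ this
    rw [mul_pow, enorm_mul, enorm_pow, enorm_pow, ← ofReal_norm z,
      ← ENNReal.ofReal_pow (norm_nonneg z)]
    gcongr
    nlinarith [Real.pi_gt_three, sq_nonneg ‖z‖]
  have ho : f =o[𝓝[≠] 0] fun z ↦ z⁻¹ := by
    have hsq' := (tendsto_zero_iff_enorm_tendsto_zero.2 hsq).norm.sqrt
    simp only [norm_pow, norm_zero, Real.sqrt_zero, Real.sqrt_sq (norm_nonneg _)] at hsq'
    refine (Asymptotics.isLittleO_iff_tendsto' ?_).2 ?_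
    · filter_upwards [self_mem_nhdsWithin] with z hz h
      exact absurd h (inv_ne_zero hz)
    · simpa [div_inv_eq_mul, mul_comm] using tendsto_zero_iff_norm_tendsto_zero.2 hsq'
  refine ⟨_, Complex.differentiableOn_update_limUnder_of_isLittleO (ball_mem_nhds 0 hR) hf ?_,
    fun z hz ↦ Function.update_of_ne hz.2 _ _⟩
  have hconst : (fun _ : ℂ ↦ f 0) =o[𝓝[≠] 0] fun z : ℂ ↦ z⁻¹ :=
    Asymptotics.isLittleO_const_left.2 <| .inr <| by
      simpa [Function.comp_def] using tendsto_norm_inv_nhdsNE_zero_atTop (α := ℂ)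
  simpa using ho.sub hconst

/-- An isolated singularity of a harmonic function with finite Dirichlet energy is removable. -/
theorem exists_harmonicOnNhd_ball_eqOn_of_lintegral_fderiv_sq_ne_top {w : ℂ → ℝ} {R : ℝ} (hR : 0 < R)
    (hw : HarmonicOnNhd w (ball 0 R \ {0}))
    (hfin : ∫⁻ z in ball 0 R \ {0}, ‖fderiv ℝ w z‖ₑ ^ 2 ≠ ∞) :
    ∃ v : ℂ → ℝ, HarmonicOnNhd v (ball 0 R) ∧ EqOn v w (ball 0 R \ {0}) := by
  have hopen : IsOpen (ball (0 : ℂ) R \ {0}) := isOpen_ball.sdiff isClosed_singleton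
  set f : ℂ → ℂ := fun z ↦ fderiv ℝ w z 1 - I * fderiv ℝ w z I with hf
  have hfd : DifferentiableOn ℂ f (ball 0 R \ {0}) := fun z hz ↦
    (HarmonicAt.differentiableAt_complex_partial (hw z hz)).differentiableWithinAt
  have hle : ∀ z, ‖f z‖ₑ ≤ 2 * ‖fderiv ℝ w z‖ₑ := fun z ↦ by
    have h1 := (fderiv ℝ w z).le_opENorm 1
    have h2 := (fderiv ℝ w z).le_opENorm I
    calc ‖f z‖ₑ ≤ ‖fderiv ℝ w z 1‖ₑ + ‖fderiv ℝ w z I‖ₑ := by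
          refine (enorm_sub_le).trans_eq ?_
          simp [← ofReal_norm]
      _ ≤ _ := by
          rw [two_mul]
          refine add_le_add ?_ ?_
          · simpa using h1
          · simpa [show ‖I‖ₑ = 1 by simp [← ofReal_norm]] using h2
  obtain ⟨F, hF, hFf⟩ := exists_differentiableOn_ball_eqOn_of_lintegral_sq_ne_top hR hfd (by
    refine ne_top_of_le_ne_top (ENNReal.mul_ne_top (by finiteness) hfin)
      ((lintegral_mono fun z ↦ ?_).trans_eq (lintegral_const_mul' (2 ^ 2) _ (by finiteness)))
    rw [← mul_pow]
    gcongr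
    exact hle z)
  obtain ⟨G, hG⟩ := hF.isExactOn_ball
  have hGd : DifferentiableOn ℂ G (ball 0 R) := fun z hz ↦
    (hG z hz).differentiableAt.differentiableWithinAt
  have hre : ∀ z ∈ ball (0 : ℂ) R,
      HasFDerivAt (fun z ↦ (G z).re)
        (reCLM ∘L (ContinuousLinearMap.toSpanSingleton ℂ (F z)).restrictScalars ℝ) z := fun z hz ↦
    reCLM.hasFDerivAt.comp z ((hG z hz).hasFDerivAt.restrictScalars ℝ)
  obtain ⟨a, ha⟩ := hopen.exists_eq_add_of_fderiv_eq
    (Complex.isPreconnected_ball_sdiff_singleton R) (𝕜 := ℝ) (f := w) (g := fun z ↦ (G z).re)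
    (fun z hz ↦ ((hw z hz).1.differentiableAt two_ne_zero).differentiableWithinAt)
    (fun z hz ↦ (hre z hz.1).differentiableAt.differentiableWithinAt) (fun z hz ↦ by
      rw [(hre z hz.1).fderiv, hFf hz]
      ext b
      nth_rw 1 [show b = b.re • (1 : ℂ) + b.im • I by simp]
      rw [map_add, map_smul, map_smul]
      simp [hf])
  refine ⟨fun z ↦ (G z).re + a, fun z hz ↦ ?_, fun z hz ↦ (ha hz).symm⟩
  exact (hGd.analyticAt (isOpen_ball.mem_nhds hz)).harmonicAt_re.add (harmonicAt_const a)

/-- The maximum principle across a puncture for harmonic functions of finite Dirichlet energy on a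
disk in the complex plane. -/
theorem InnerProductSpace.HarmonicOnNhd.le_of_forall_mem_sphere_le_of_lintegral_fderiv_sq_ne_top
    {w : ℂ → ℝ} {R m : ℝ} (hR : 0 < R)
    (hcont : ContinuousOn w (closedBall 0 R \ {0}))
    (hw : HarmonicOnNhd w (ball 0 R \ {0}))
    (hfin : ∫⁻ z in ball 0 R \ {0}, ‖fderiv ℝ w z‖ₑ ^ 2 ≠ ∞)
    (hm : ∀ z ∈ sphere 0 R, w z ≤ m) {z : ℂ} (hz : z ∈ closedBall 0 R) (hz0 : z ≠ 0) :
    w z ≤ m := by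
  obtain ⟨v, hv, hvw⟩ :=
    exists_harmonicOnNhd_ball_eqOn_of_lintegral_fderiv_sq_ne_top hR hw hfin
  set v' := Function.update w 0 (v 0) with hv'
  have hne : ∀ z ≠ 0, v' z = w z := fun z hz ↦ Function.update_of_ne hz _ _
  have heq : EqOn v v' (ball 0 R) := fun z hz ↦ by
    by_cases h : z = 0
    · simp [h, hv']
    · rw [hvw ⟨hz, h⟩, hne z h]
  have hharm : HarmonicOnNhd v' (ball 0 R) := fun z hz ↦
    (harmonicAt_congr_nhds (heq.eventuallyEq_of_mem (isOpen_ball.mem_nhds hz))).1 (hv z hz)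
  have hcl : HarmonicContOnCl v' (ball 0 R) := by
    refine .mk_ball hharm fun z hz ↦ ?_
    by_cases h : z = 0
    · subst h
      exact (hharm 0 (mem_ball_self hR)).1.continuousAt.continuousWithinAt
    · exact continuousWithinAt_update_of_ne h |>.2 <|
        (hcont z ⟨hz, h⟩).mono_of_mem_nhdsWithin
          (inter_mem_nhdsWithin _ (isOpen_compl_singleton.mem_nhds h))
  rw [← hne z hz0]
  refine hcl.le_of_forall_mem_sphere_le hR (fun p hp ↦ ?_) hz
  rw [hne p (ne_of_mem_sphere hp hR.ne')]
  exact hm p hp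

/-- Maximum principle across a puncture for finite-energy harmonic functions: if `u` is
continuous on the closed unit disk minus the origin, `C²` and harmonic on the punctured
open unit disk, has finite Dirichlet energy there, and `u ≤ m` on the unit circle, then
`u ≤ m` on the whole punctured closed disk. -/
theorem punctured_maximum_principle
    (m : ℝ) (u : EuclideanSpace ℝ (Fin 2) → ℝ)
    (hcont : ContinuousOn u (closedBall (0 : EuclideanSpace ℝ (Fin 2)) 1 \ {0}))
    (hC2 : ContDiffOn ℝ 2 u (ball (0 : EuclideanSpace ℝ (Fin 2)) 1 \ {0}))
    (hharm : ∀ x ∈ ball (0 : EuclideanSpace ℝ (Fin 2)) 1 \ {0},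
      ∑ i : Fin 2,
        iteratedFDeriv ℝ 2 u x (fun _ => EuclideanSpace.single i (1 : ℝ)) = 0)
    (henergy : IntegrableOn (fun x => ‖gradient u x‖ ^ 2)
      (ball (0 : EuclideanSpace ℝ (Fin 2)) 1 \ {0}))
    (hbdry : ∀ x : EuclideanSpace ℝ (Fin 2), ‖x‖ = 1 → u x ≤ m) :
    ∀ x ∈ closedBall (0 : EuclideanSpace ℝ (Fin 2)) 1, x ≠ 0 → u x ≤ m := by
  intro x hx hx0
  let e : ℂ ≃ₗᵢ[ℝ] EuclideanSpace ℝ (Fin 2) := Complex.orthonormalBasisOneI.repr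
  have hopen : IsOpen (ball (0 : EuclideanSpace ℝ (Fin 2)) 1 \ {0}) :=
    isOpen_ball.sdiff isClosed_singleton
  have hball : ∀ z, z ∈ ball (0 : ℂ) 1 \ {0} ↔
      e z ∈ ball (0 : EuclideanSpace ℝ (Fin 2)) 1 \ {0} := fun z ↦ by simp
  have hw := HarmonicOnNhd.le_of_forall_mem_sphere_le_of_lintegral_fderiv_sq_ne_top (w := u ∘ e)
    (m := m) one_pos ?_ ?_ ?_ ?_ (z := e.symm x) (by simpa using hx) (by simpa using hx0)
  · simpa using hw
  · exact hcont.comp e.continuous.continuousOn fun z hz ↦ by simpa using hz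
  · intro z hz
    have hz' := (hball z).1 hz
    refine ⟨(hC2.contDiffAt (hopen.mem_nhds hz')).comp z e.contDiff.contDiffAt, ?_⟩
    filter_upwards [(hopen.preimage e.continuous).mem_nhds hz'] with y hy
    rw [e.laplacian_comp_right,
      laplacian_eq_iteratedFDeriv_orthonormalBasis u (EuclideanSpace.basisFun (Fin 2) ℝ),
      Pi.zero_apply, ← hharm (e y) hy]
    refine Finset.sum_congr rfl fun i _ ↦ congrArg _ (funext fun j ↦ ?_)
    fin_cases j <;> simp
  · have hint := (e.measurePreserving.integrableOn_comp_preimage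
      e.toHomeomorph.measurableEmbedding).2 henergy
    rw [show e ⁻¹' (ball 0 1 \ {0}) = ball 0 1 \ {0} from Set.ext fun z ↦ (hball z).symm] at hint
    refine ((lintegral_congr fun z ↦ ?_).trans_lt hint.hasFiniteIntegral).ne
    have hz : ‖fderiv ℝ (u ∘ e) z‖ = ‖gradient u (e z)‖ := by
      simpa [gradient, norm_iteratedFDeriv_one] using e.norm_iteratedFDeriv_comp_right u z 1
    rw [Function.comp_apply, enorm_pow, enorm_norm, ← ofReal_norm, ← ofReal_norm, hz]
  · exact fun z hz ↦ hbdry _ (by simpa using hz)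
end
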